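/- Let T₁, T₂ : M → A be two compatible Rota–Baxter operators on an anti-flexible algebra (A,·) with respect to a bimodule (M,l,r) (i.e. T₁, T₂ and T₁ + T₂ are all Rota–Baxter operators). If T₂ is invertible, then the triple (T₂, N, S) with N = T₁∘T₂⁻¹ and S = T₂⁻¹∘T₁ is an ON-structure on (A,·) with respect to (M,l,r): (N,S) is a Nijenhuis structure on the A-bimodule M, N∘T₂ = T₂∘S, and m ⋆_{N∘T₂} n = m ⋆^S_{T₂} n for all m, n ∈ M. -/

import Mathlib

/-- The anti-flexible identity for a (bilinear) product. -/
def AntiFlexible {A : Type*} [AddCommGroup A] (mul : A → A → A) : Prop :=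
  ∀ a b c : A, mul (mul a b) c - mul a (mul b c) = mul (mul c b) a - mul c (mul b a)

/-- The bimodule equations for `(M, l, r)` over `(A, mul)`. -/
def IsBimodule {K A M : Type*} [Field K] [AddCommGroup A] [Module K A]
    [AddCommGroup M] [Module K M]
    (mul : A →ₗ[K] A →ₗ[K] A) (l r : A →ₗ[K] Module.End K M) : Prop :=
  (∀ a b : A, l (mul a b) - l a * l b = r a * r b - r (mul b a)) ∧
  (∀ a b : A, l a * r b - r b * l a = l b * r a - r a * l b)

/-- Rota–Baxter operator `T : M → A`. -/
def IsRotaBaxter {K A M : Type*} [Field K] [AddCommGroup A] [Module K A]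
    [AddCommGroup M] [Module K M]
    (mul : A →ₗ[K] A →ₗ[K] A) (l r : A →ₗ[K] Module.End K M) (T : M →ₗ[K] A) : Prop :=
  ∀ m n : M, mul (T m) (T n) = T (l (T m) n + r (T n) m)

/-- Nijenhuis operator on `(A, mul)`. -/
def IsNijenhuis {A : Type*} [AddCommGroup A] (mul : A → A → A) (N : A → A) : Prop :=
  ∀ a b : A, mul (N a) (N b) = N (mul (N a) b + mul a (N b) - N (mul a b))

/-- A Nijenhuis structure `(N, S)` on the `A`-bimodule `M`. -/
def IsNijenhuisStructure {K A M : Type*} [Field K] [AddCommGroup A] [Module K A]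
    [AddCommGroup M] [Module K M]
    (mul : A →ₗ[K] A →ₗ[K] A) (l r : A →ₗ[K] Module.End K M)
    (N : Module.End K A) (S : Module.End K M) : Prop :=
  IsNijenhuis (fun a b => mul a b) N ∧
  (∀ (a : A) (m : M),
    l (N a) (S m) = S (l (N a) m) + l a (S (S m)) - S (l a (S m))) ∧
  (∀ (a : A) (m : M),
    r (N a) (S m) = S (r (N a) m) + r a (S (S m)) - S (r a (S m)))

/-- The product `m ⋆_Q n = l(Q m)n + r(Q n)m` on `M` induced by a map `Q : M → A`. -/
def starQ {K A M : Type*} [Field K] [AddCommGroup A] [Module K A]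
    [AddCommGroup M] [Module K M]
    (l r : A →ₗ[K] Module.End K M) (Q : M → A) : M → M → M :=
  fun m n => l (Q m) n + r (Q n) m

/-- The product `m ⋆^S_T n = S(m) ⋆_T n + m ⋆_T S(n) − S(m ⋆_T n)`. -/
def starST {K A M : Type*} [Field K] [AddCommGroup A] [Module K A]
    [AddCommGroup M] [Module K M]
    (l r : A →ₗ[K] Module.End K M) (T : M →ₗ[K] A) (S : Module.End K M) : M → M → M :=
  fun m n => starQ l r (⇑T) (S m) n + starQ l r (⇑T) m (S n) - S (starQ l r (⇑T) m n)

/-- An `ON`-structure `(T, N, S)` on the anti-flexible algebra `(A, mul)` with respect to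
the bimodule `(M, l, r)`. -/
def IsONStructure {K A M : Type*} [Field K] [AddCommGroup A] [Module K A]
    [AddCommGroup M] [Module K M]
    (mul : A →ₗ[K] A →ₗ[K] A) (l r : A →ₗ[K] Module.End K M)
    (T : M →ₗ[K] A) (N : Module.End K A) (S : Module.End K M) : Prop :=
  IsRotaBaxter mul l r T ∧
  IsNijenhuisStructure mul l r N S ∧
  (∀ m : M, N (T m) = T (S m)) ∧
  (∀ m n : M, starQ l r (fun m => N (T m)) m n = starST l r T S m n)

/-- if `T₁, T₂` are compatible Rota–Baxter operators and `T₂` is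
invertible (with inverse `T₂inv`), then `(T₂, N = T₁ ∘ T₂⁻¹, S = T₂⁻¹ ∘ T₁)` is an
`ON`-structure on `(A, ·)` with respect to the bimodule `(M, l, r)`. -/
theorem compatible_rotaBaxter_ON_structure {K A M : Type*} [Field K]
    [AddCommGroup A] [Module K A] [AddCommGroup M] [Module K M]
    (mul : A →ₗ[K] A →ₗ[K] A) (hA : AntiFlexible fun a b => mul a b)
    (l r : A →ₗ[K] Module.End K M) (hbim : IsBimodule mul l r)
    (T₁ T₂ : M →ₗ[K] A)
    (hT₁ : IsRotaBaxter mul l r T₁) (hT₂ : IsRotaBaxter mul l r T₂)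
    (hcomp : IsRotaBaxter mul l r (T₁ + T₂))
    (T₂inv : A →ₗ[K] M)
    (hinv₁ : T₂ ∘ₗ T₂inv = LinearMap.id) (hinv₂ : T₂inv ∘ₗ T₂ = LinearMap.id) :
    IsONStructure mul l r T₂ (T₁ ∘ₗ T₂inv) (T₂inv ∘ₗ T₁) := by
  set S : Module.End K M := T₂inv ∘ₗ T₁
  have left_inv : ∀ m, T₂inv (T₂ m) = m := LinearMap.congr_fun hinv₂
  have right_inv : ∀ a, T₂ (T₂inv a) = a := LinearMap.congr_fun hinv₁
  have T₂_S : ∀ m, T₂ (S m) = T₁ m := fun m => right_inv (T₁ m)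
  have T₂_inj : Function.Injective T₂ := Function.LeftInverse.injective left_inv
  -- `S` intertwines the two products on `M`.
  have hmul : ∀ m n, l (T₁ m) (S n) + r (T₁ n) (S m) = S (l (T₁ m) n + r (T₁ n) m) := by
    intro m n
    apply T₂_inj
    rw [T₂_S, ← hT₁ m n, ← T₂_S m, ← T₂_S n, hT₂]
  -- The mixed terms of the Rota–Baxter identity for `T₁ + T₂`.
  have hmix : ∀ m n, l (T₂ m) (S n) + r (T₂ n) (S m) = S (l (T₂ m) n + r (T₂ n) m) := by
    intro m n
    apply T₂_inj
    have h := hcomp m n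
    have h₁ := hT₁ m n
    have h₂ := hT₂ m n
    have h₃ := hT₂ (S m) n
    have h₄ := hT₂ m (S n)
    simp only [T₂_S] at h₃ h₄ ⊢
    simp only [LinearMap.add_apply, map_add] at h h₁ h₂ h₃ h₄ ⊢
    rw [h₁, h₂, h₃, h₄] at h
    linear_combination (norm := module) h
  refine ⟨hT₂, ⟨?_, ?_, ?_⟩, ?_, ?_⟩
  · intro a b
    obtain ⟨m, rfl⟩ : ∃ m, T₂ m = a := ⟨_, right_inv a⟩
    obtain ⟨n, rfl⟩ : ∃ n, T₂ n = b := ⟨_, right_inv b⟩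
    have h₃ := hT₂ (S m) n
    have h₄ := hT₂ m (S n)
    rw [T₂_S] at h₃ h₄
    simp only [LinearMap.comp_apply, left_inv]
    rw [hT₁, h₃, h₄, hT₂ m n, left_inv, ← T₂_S (l (T₂ m) n + r (T₂ n) m), ← hmix]
    simp only [← map_add, ← map_sub, left_inv]
    congr 1
    abel
  · intro a m
    obtain ⟨p, rfl⟩ : ∃ p, T₂ p = a := ⟨_, right_inv a⟩
    have h₁ := hmul p m
    have h₂ := hmix p (S m)
    simp only [LinearMap.comp_apply, left_inv, T₂_S, map_add] at h₁ h₂ ⊢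
    linear_combination (norm := module) h₁ - h₂
  · intro a m
    obtain ⟨p, rfl⟩ : ∃ p, T₂ p = a := ⟨_, right_inv a⟩
    have h₁ := hmul m p
    have h₂ := hmix (S m) p
    simp only [LinearMap.comp_apply, left_inv, T₂_S, map_add] at h₁ h₂ ⊢
    linear_combination (norm := module) h₁ - h₂
  · intro m
    simp only [LinearMap.comp_apply, left_inv, T₂_S]
  · intro m n
    have h := hmix m n
    simp only [starQ, starST, LinearMap.comp_apply, left_inv, T₂_S] at h ⊢
    rw [← h]
    abel
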